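/- Let Λ be a real diagonal N×N matrix with Λ_i + Λ_j > 0 for all i ≠ j, let J(Ω) = ΛΩ + ΩΛ on skew-symmetric matrices, and for N×N matrices Q, P set M(Q,P) := QᵀP − PᵀQ and Ω(Q,P) := J⁻¹(M(Q,P)) (the unique skew-symmetric solution of J(Ω) = M). Define the Hamiltonian H(Q,P) := (1/4)·⟨J⁻¹(M(Q,P)), M(Q,P)⟩, where ⟨X, Y⟩ = (1/2)·trace(XᵀY). Then H is differentiable and its Fréchet derivative at (Q,P) in the direction (A,B) equals ⟨Q·Ω(Q,P), B⟩ − ⟨P·Ω(Q,P), A⟩. Consequently the canonical Hamiltonian equations Q' = ∂H/∂P, P' = −∂H/∂Q (gradients taken with respect to the trace inner product) are exactly Q' = QΩ, P' = PΩ. -/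

import Mathlib

open Matrix

attribute [local instance] Matrix.frobeniusNormedAddCommGroup Matrix.frobeniusNormedSpace

/-- The momentum map `M(Q,P) = QᵀP - PᵀQ`. -/
noncomputable def rbMomentum {N : ℕ} (Q P : Matrix (Fin N) (Fin N) ℝ) :
    Matrix (Fin N) (Fin N) ℝ :=
  Qᵀ * P - Pᵀ * Q

/-- The inverse inertia operator: `(J⁻¹M)_{ij} = M_{ij}/(Λ_i + Λ_j)` for
`i ≠ j`, and `0` on the diagonal. -/
noncomputable def rbJinv {N : ℕ} (Λ M : Matrix (Fin N) (Fin N) ℝ) :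
    Matrix (Fin N) (Fin N) ℝ :=
  Matrix.of fun i j => if i = j then (0 : ℝ) else M i j / (Λ i i + Λ j j)

/-- The rigid body Hamiltonian
`H(Q,P) = (1/4)·⟨J⁻¹M(Q,P), M(Q,P)⟩ = (1/8)·trace((J⁻¹M)ᵀ M)`. -/
noncomputable def rbHamiltonian {N : ℕ} (Λ : Matrix (Fin N) (Fin N) ℝ)
    (QP : Matrix (Fin N) (Fin N) ℝ × Matrix (Fin N) (Fin N) ℝ) : ℝ :=
  (1 / 8 : ℝ) * ((rbJinv Λ (rbMomentum QP.1 QP.2))ᵀ * rbMomentum QP.1 QP.2).trace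

/-- The bilinear form `tr((J⁻¹X)ᵀ Y)`. -/
noncomputable def rbForm {N : ℕ} (Λ X Y : Matrix (Fin N) (Fin N) ℝ) : ℝ :=
  ((rbJinv Λ X)ᵀ * Y).trace

theorem rbForm_symm {N : ℕ} (Λ X Y : Matrix (Fin N) (Fin N) ℝ) :
    rbForm Λ X Y = rbForm Λ Y X := by
  simp only [rbForm, rbJinv, Matrix.trace, Matrix.diag_apply, Matrix.mul_apply,
    Matrix.transpose_apply, Matrix.of_apply]
  refine Finset.sum_congr rfl fun i _ => Finset.sum_congr rfl fun j _ => ?_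
  split_ifs <;> ring

theorem rbForm_add_right {N : ℕ} (Λ X Y Z : Matrix (Fin N) (Fin N) ℝ) :
    rbForm Λ X (Y + Z) = rbForm Λ X Y + rbForm Λ X Z := by
  simp [rbForm, Matrix.mul_add]

theorem rbForm_smul_right {N : ℕ} (Λ X Y : Matrix (Fin N) (Fin N) ℝ) (t : ℝ) :
    rbForm Λ X (t • Y) = t * rbForm Λ X Y := by
  simp [rbForm]

theorem rbForm_add_left {N : ℕ} (Λ X Y Z : Matrix (Fin N) (Fin N) ℝ) :
    rbForm Λ (Y + Z) X = rbForm Λ Y X + rbForm Λ Z X := by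
  rw [rbForm_symm, rbForm_add_right, rbForm_symm Λ X, rbForm_symm Λ X]

theorem rbForm_smul_left {N : ℕ} (Λ X Y : Matrix (Fin N) (Fin N) ℝ) (t : ℝ) :
    rbForm Λ (t • Y) X = t * rbForm Λ Y X := by
  rw [rbForm_symm, rbForm_smul_right, rbForm_symm Λ X]

theorem rbMomentum_line {N : ℕ} (Q P A B : Matrix (Fin N) (Fin N) ℝ) (t : ℝ) :
    rbMomentum (Q + t • A) (P + t • B) =
      rbMomentum Q P + (t • (rbMomentum Q B + rbMomentum A P) + (t * t) • rbMomentum A B) := by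
  simp only [rbMomentum, Matrix.transpose_add, Matrix.transpose_smul, Matrix.add_mul,
    Matrix.mul_add, Matrix.smul_mul, Matrix.mul_smul, smul_sub, smul_add, mul_smul]
  abel

theorem rbJinv_skew {N : ℕ} (Λ Q P : Matrix (Fin N) (Fin N) ℝ) :
    (rbJinv Λ (rbMomentum Q P))ᵀ = -rbJinv Λ (rbMomentum Q P) := by
  have h : ∀ i j, rbMomentum Q P j i = - rbMomentum Q P i j := by
    intro i j
    have : (rbMomentum Q P)ᵀ = - rbMomentum Q P := by simp [rbMomentum]
    exact congrFun (congrFun this i) j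
  ext i j
  simp only [rbJinv, Matrix.transpose_apply, Matrix.of_apply, Matrix.neg_apply, h i j, eq_comm,
    add_comm (Λ j j)]
  split_ifs <;> ring

theorem trace_skew_momentum {N : ℕ} (W Q B : Matrix (Fin N) (Fin N) ℝ) (hW : Wᵀ = -W) :
    (Wᵀ * rbMomentum Q B).trace = 2 * ((Q * W)ᵀ * B).trace := by
  have h1 : (Wᵀ * (Bᵀ * Q)).trace = - (Wᵀ * (Qᵀ * B)).trace := by
    rw [← Matrix.trace_transpose]
    simp only [Matrix.transpose_mul, Matrix.transpose_transpose]
    rw [Matrix.trace_mul_comm, hW]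
    simp
  rw [rbMomentum, Matrix.mul_sub, Matrix.trace_sub, h1, Matrix.transpose_mul, Matrix.mul_assoc]
  ring

theorem rbMomentum_swap {N : ℕ} (A P : Matrix (Fin N) (Fin N) ℝ) :
    rbMomentum A P = - rbMomentum P A := by
  simp [rbMomentum]

theorem differentiable_rbHamiltonian {N : ℕ} (Λ : Matrix (Fin N) (Fin N) ℝ) :
    Differentiable ℝ (rbHamiltonian Λ) := by
  have e1 : ∀ i j, Differentiable ℝ
      (fun p : Matrix (Fin N) (Fin N) ℝ × Matrix (Fin N) (Fin N) ℝ => p.1 i j) := fun i j =>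
    (LinearMap.toContinuousLinearMap ((Matrix.entryLinearMap ℝ ℝ i j).comp
      (LinearMap.fst ℝ (Matrix (Fin N) (Fin N) ℝ) (Matrix (Fin N) (Fin N) ℝ)))).differentiable
  have e2 : ∀ i j, Differentiable ℝ
      (fun p : Matrix (Fin N) (Fin N) ℝ × Matrix (Fin N) (Fin N) ℝ => p.2 i j) := fun i j =>
    (LinearMap.toContinuousLinearMap ((Matrix.entryLinearMap ℝ ℝ i j).comp
      (LinearMap.snd ℝ (Matrix (Fin N) (Fin N) ℝ) (Matrix (Fin N) (Fin N) ℝ)))).differentiable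
  have eM : ∀ i j, Differentiable ℝ
      (fun p : Matrix (Fin N) (Fin N) ℝ × Matrix (Fin N) (Fin N) ℝ =>
        rbMomentum p.1 p.2 i j) := by
    intro i j
    simp only [rbMomentum, Matrix.sub_apply, Matrix.mul_apply, Matrix.transpose_apply]
    exact (Differentiable.fun_sum fun k _ => (e1 k i).mul (e2 k j)).sub
      (Differentiable.fun_sum fun k _ => (e2 k i).mul (e1 k j))
  have : rbHamiltonian Λ = fun p => (1 / 8 : ℝ) * ∑ i, ∑ j,
      (if j = i then (0 : ℝ) else rbMomentum p.1 p.2 j i / (Λ j j + Λ i i)) *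
        rbMomentum p.1 p.2 j i := by
    funext p
    simp only [rbHamiltonian, rbJinv, Matrix.trace, Matrix.diag_apply, Matrix.mul_apply,
      Matrix.transpose_apply, Matrix.of_apply]
  rw [this]
  refine Differentiable.const_mul (Differentiable.fun_sum fun i _ =>
    Differentiable.fun_sum fun j _ => Differentiable.mul ?_ (eM j i)) _
  split_ifs
  · exact differentiable_const _
  · simp only [div_eq_mul_inv]
    exact (eM j i).mul (differentiable_const _)

/-- **The symmetric rigid body system is canonically Hamiltonian.**
For `Λ` diagonal with `Λ_i + Λ_j > 0` (`i ≠ j`), the Hamiltonian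
`H(Q,P) = (1/4)⟨J⁻¹M(Q,P), M(Q,P)⟩` is (Fréchet) differentiable and its
derivative at `(Q,P)` in the direction `(A,B)` is
`⟨QΩ, B⟩ - ⟨PΩ, A⟩` with `Ω := J⁻¹(M(Q,P))` and `⟨X,Y⟩ = (1/2)trace(XᵀY)`;
hence the canonical Hamiltonian equations `Q' = ∂H/∂P`, `P' = -∂H/∂Q`
(gradients with respect to the trace inner product) are exactly
`Q' = QΩ`, `P' = PΩ`. -/
theorem rigid_body_hamiltonian_frechet_derivative
    {N : ℕ} (Λ : Matrix (Fin N) (Fin N) ℝ)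
    (hΛdiag : ∀ i j : Fin N, i ≠ j → Λ i j = 0)
    (hΛpos : ∀ i j : Fin N, i ≠ j → 0 < Λ i i + Λ j j)
    (Q P : Matrix (Fin N) (Fin N) ℝ) :
    ∃ L : (Matrix (Fin N) (Fin N) ℝ × Matrix (Fin N) (Fin N) ℝ) →L[ℝ] ℝ,
      HasFDerivAt (rbHamiltonian Λ) L (Q, P) ∧
      ∀ A B : Matrix (Fin N) (Fin N) ℝ,
        L (A, B)
          = (1 / 2 : ℝ) * ((Q * rbJinv Λ (rbMomentum Q P))ᵀ * B).trace
            - (1 / 2 : ℝ) * ((P * rbJinv Λ (rbMomentum Q P))ᵀ * A).trace := by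
  have hd := (differentiable_rbHamiltonian Λ (Q, P)).hasFDerivAt
  refine ⟨fderiv ℝ (rbHamiltonian Λ) (Q, P), hd, fun A B => ?_⟩
  have hline := hd.hasLineDerivAt (A, B)
  have hpoly : (fun t : ℝ => rbHamiltonian Λ ((Q, P) + t • (A, B))) = fun t : ℝ =>
      (1 / 8 : ℝ) * (rbForm Λ (rbMomentum Q P) (rbMomentum Q P)
        + t * (2 * rbForm Λ (rbMomentum Q P) (rbMomentum Q B + rbMomentum A P))
        + t ^ 2 * (2 * rbForm Λ (rbMomentum Q P) (rbMomentum A B)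
          + rbForm Λ (rbMomentum Q B + rbMomentum A P) (rbMomentum Q B + rbMomentum A P))
        + t ^ 3 * (2 * rbForm Λ (rbMomentum Q B + rbMomentum A P) (rbMomentum A B))
        + t ^ 4 * rbForm Λ (rbMomentum A B) (rbMomentum A B)) := by
    funext t
    change (1 / 8 : ℝ) * rbForm Λ (rbMomentum (Q + t • A) (P + t • B))
      (rbMomentum (Q + t • A) (P + t • B)) = _
    rw [rbMomentum_line]
    generalize rbMomentum Q B + rbMomentum A P = Y
    generalize rbMomentum Q P = X
    generalize rbMomentum A B = Z
    simp only [rbForm_add_left, rbForm_add_right, rbForm_smul_left, rbForm_smul_right]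
    rw [rbForm_symm Λ Y X, rbForm_symm Λ Z X, rbForm_symm Λ Z Y]
    ring
  rw [HasLineDerivAt, hpoly] at hline
  have key : ∀ a b c d e : ℝ, HasDerivAt (fun t : ℝ =>
      (1 / 8 : ℝ) * (a + t * (2 * b) + t ^ 2 * c + t ^ 3 * d + t ^ 4 * e)) (1 / 4 * b) 0 := by
    intro a b c d e
    have h := ((((((hasDerivAt_id (0 : ℝ)).mul_const (2 * b)).const_add a).add
      ((hasDerivAt_pow 2 (0 : ℝ)).mul_const c)).add
      ((hasDerivAt_pow 3 (0 : ℝ)).mul_const d)).add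
      ((hasDerivAt_pow 4 (0 : ℝ)).mul_const e)).const_mul (1 / 8 : ℝ)
    refine h.congr_deriv ?_
    norm_num
    ring
  refine (hline.unique (key _ _ _ _ _)).trans ?_
  rw [rbForm_add_right, rbMomentum_swap A P]
  have hs := rbJinv_skew Λ Q P
  have h1 := trace_skew_momentum _ Q B hs
  have h2 := trace_skew_momentum _ P A hs
  simp only [rbForm, Matrix.mul_neg, Matrix.trace_neg]
  rw [h1, h2]
  ring
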